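/- There are no Gaussian integers x, y, z with xyz ≠ 0, gcd(x, y, z) a unit, y divisible by 1+i, such that x^4 - 6(1+i)·x^2y^2 + 2i·y^4 = z^2. -/

import Mathlib

open Zsqrtd

namespace GDesc

abbrev I : GaussianInt := sqrtd
abbrev L : GaussianInt := 1 + sqrtd

lemma hI : I * I = -1 := by ext <;> simp [I]

lemma L_dvd_iff (z : GaussianInt) : L ∣ z ↔ (z.re + z.im) % 2 = 0 := by
  constructor
  · rintro ⟨w, rfl⟩
    simp [L]; omega
  · intro h
    refine ⟨⟨(z.re + z.im) / 2, (z.im - z.re) / 2⟩, ?_⟩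
    ext <;> simp [L] <;> omega

lemma prime_L : Prime L := by
  refine ⟨?_, ?_, ?_⟩
  · intro h
    have := congrArg Zsqrtd.im h
    simp [L] at this
  · intro h
    have := (L_dvd_iff 1).1 h.dvd
    simp at this
  · intro a b h
    rw [L_dvd_iff] at h ⊢
    rw [L_dvd_iff]
    have h1 : ((a.re + a.im) * (b.re + b.im)) % 2 = 0 := by
      have : (a.re + a.im) * (b.re + b.im) = ((a * b).re + (a * b).im) + 2 * (a.im * b.im) := by
        simp; ring
      omega
    rcases Int.emod_two_eq_zero_or_one (a.re + a.im) with h2 | h2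
    · exact Or.inl h2
    · right
      rw [Int.mul_emod, h2] at h1
      simpa using h1

lemma not_dvd_iff (z : GaussianInt) : ¬ L ∣ z ↔ (z.re + z.im) % 2 = 1 := by
  rw [L_dvd_iff]; omega

lemma units (e f : GaussianInt) (h : e * f = 1) :
    (e = 1 ∧ f = 1) ∨ (e = -1 ∧ f = -1) ∨ (e = I ∧ f = -I) ∨ (e = -I ∧ f = I) := by
  have hn : e.norm = 1 := by
    have := (Zsqrtd.norm_eq_one_iff' (by norm_num) e).2 (IsUnit.of_mul_eq_one f h)
    exact this
  have hf : f = star e := by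
    have h2 : e * star e = 1 := by
      rw [← Zsqrtd.norm_eq_mul_conj, hn]; rfl
    have he : e ≠ 0 := by rintro rfl; simp at h
    exact mul_left_cancel₀ he (h.trans h2.symm)
  rw [Zsqrtd.norm_def] at hn
  have h1 : e.re ≤ 1 := by nlinarith [mul_self_nonneg e.im]
  have h2 : -1 ≤ e.re := by nlinarith [mul_self_nonneg e.im]
  have h3 : e.im ≤ 1 := by nlinarith
  have h4 : -1 ≤ e.im := by nlinarith
  obtain ⟨a, b⟩ := e
  subst hf
  simp only at *
  interval_cases a <;> interval_cases b <;> simp_all [Zsqrtd.ext_iff, I]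

lemma odd_sq (s : GaussianInt) (h : ¬ L ∣ s) : ∃ k, s ^ 2 = 1 + 4 * k ∨ s ^ 2 = -1 + 4 * k := by
  rw [not_dvd_iff] at h
  obtain ⟨a, b⟩ := s
  simp only at h
  rcases Int.emod_two_eq_zero_or_one a with ha | ha
  · obtain ⟨m, rfl⟩ : ∃ m, a = 2 * m := ⟨a / 2, by omega⟩
    obtain ⟨n, rfl⟩ : ∃ n, b = 2 * n + 1 := ⟨b / 2, by omega⟩
    refine ⟨⟨m ^ 2 - n ^ 2 - n, m * (2 * n + 1)⟩, Or.inr ?_⟩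
    ext <;> simp [pow_two] <;> ring
  · obtain ⟨m, rfl⟩ : ∃ m, a = 2 * m + 1 := ⟨a / 2, by omega⟩
    obtain ⟨n, rfl⟩ : ∃ n, b = 2 * n := ⟨b / 2, by omega⟩
    refine ⟨⟨m ^ 2 - n ^ 2 + m, n * (2 * m + 1)⟩, Or.inl ?_⟩
    ext <;> simp [pow_two] <;> ring

lemma odd_4 (s : GaussianInt) (h : ¬ L ∣ s) : ∃ k, s ^ 4 = 1 + 4 * k := by
  obtain ⟨k, h | h⟩ := odd_sq s h
  · exact ⟨2 * k + 4 * k ^ 2, by linear_combination (s ^ 2 + 1 + 4 * k) * h⟩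
  · exact ⟨-2 * k + 4 * k ^ 2, by linear_combination (s ^ 2 - 1 + 4 * k) * h⟩

lemma any_4 (s : GaussianInt) : ∃ k, s ^ 4 = 1 + 4 * k ∨ s ^ 4 = 4 * k := by
  by_cases h : L ∣ s
  · obtain ⟨t, rfl⟩ := h
    refine ⟨-t ^ 4, Or.inr ?_⟩
    linear_combination (t ^ 4 * (I ^ 2 + 4 * I + 5)) * hI
  · obtain ⟨k, hk⟩ := odd_4 s h
    exact ⟨k, Or.inl hk⟩

lemma cop_of (a b : GaussianInt) (hb : a ≠ 0 ∨ b ≠ 0)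
    (h : ∀ p : GaussianInt, Prime p → p ∣ a → p ∣ b → False) : IsCoprime a b := by
  refine isCoprime_of_prime_dvd (fun hh => ?_) h
  rcases hb with hb | hb
  · exact hb hh.1
  · exact hb hh.2

lemma split (n : ℕ) (hn : n ≠ 0) (p q w : GaussianInt) (hc : IsCoprime p q) (h : p * q = w ^ n)
    (hw : w ≠ 0) : ∃ e f c d : GaussianInt, e * f = 1 ∧ p = e * c ^ n ∧ q = f * d ^ n ∧ w = c * d ∧
      IsCoprime c d := by
  obtain ⟨c, hc1⟩ := exists_associated_pow_of_mul_eq_pow' hc h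
  obtain ⟨d, hd1⟩ := exists_associated_pow_of_mul_eq_pow' hc.symm ((mul_comm q p).trans h)
  have h2 : Associated ((c * d) ^ n) (w ^ n) := by
    rw [mul_pow, ← h]; exact hc1.mul_mul hd1
  have h3 : Associated (c * d) w :=
    associated_of_dvd_dvd ((IsIntegrallyClosed.pow_dvd_pow_iff hn).1 h2.dvd) ((IsIntegrallyClosed.pow_dvd_pow_iff hn).1 h2.symm.dvd)
  obtain ⟨g, hg⟩ := h3
  obtain ⟨e, he⟩ := hc1
  have hc0 : c ≠ 0 := by rintro rfl; simp at hg; exact hw hg.symm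
  have he1 : (e : GaussianInt) * ((e⁻¹ : GaussianIntˣ) : GaussianInt) = 1 := by simp
  refine ⟨e, (e⁻¹ : GaussianIntˣ), c, d * g, he1, by rw [← he]; ring, ?_, by rw [← hg]; ring, ?_⟩
  · apply mul_left_cancel₀ (pow_ne_zero n hc0)
    have h4 : c ^ n * e * q = (c * (d * g)) ^ n := by rw [he, h, ← hg]; ring
    rw [mul_pow] at h4
    linear_combination ((e⁻¹ : GaussianIntˣ) : GaussianInt) * h4 - c ^ n * q * he1
  · have h5 : IsCoprime c d :=
      (hc.of_isCoprime_of_dvd_left ((dvd_pow_self c hn).trans ⟨_, he.symm⟩)).of_isCoprime_of_dvd_right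
        ((dvd_pow_self d hn).trans hd1.dvd)
    exact (isCoprime_mul_unit_right_right g.isUnit c d).2 h5

lemma hL2 : L * L = 2 * I := by linear_combination hI
lemma four_ne : (4 : GaussianInt) ≠ 0 := by decide
lemma L0 : L ≠ 0 := prime_L.ne_zero
lemma I0 : I ≠ 0 := by intro h; have := hI; rw [h] at this; simp at this
lemma L_dvd_two : L ∣ 2 := ⟨1 - I, by linear_combination hI⟩

lemma not_dvd_I {z : GaussianInt} (h : ¬ L ∣ z) : ¬ L ∣ I * z := by
  intro h1
  exact h (by have := h1.mul_left (-I); rwa [show -I * (I * z) = z by linear_combination -z * hI] at this)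

lemma cop_L {z : GaussianInt} (h : ¬ L ∣ z) : IsCoprime L z :=
  (prime_L.irreducible.coprime_iff_not_dvd).2 h

lemma mod1 (e f k l j a2 : GaussianInt) (h : e * f = 1) (ha : a2 = 1 + 4 * j ∨ a2 = -1 + 4 * j)
    (h2 : e * (1 + 4 * k) + f * (1 + 4 * l) = (1 - I) * a2) : False := by
  have h3 := congrArg Zsqrtd.re h2
  have h4 := congrArg Zsqrtd.im h2
  rcases units e f h with ⟨rfl, rfl⟩ | ⟨rfl, rfl⟩ | ⟨rfl, rfl⟩ | ⟨rfl, rfl⟩ <;>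
  rcases ha with rfl | rfl <;> simp [I] at h3 h4 <;> omega

lemma mod2 (e k l j a2 d4 : GaussianInt) (h : e = 1 ∨ e = -1) (ha : a2 = 1 + 4 * j ∨ a2 = -1 + 4 * j)
    (hd : d4 = 1 + 4 * l ∨ d4 = 4 * l)
    (h2 : e * (1 + 4 * k) + 2 * I * e * d4 = - I * a2) : False := by
  have h3 := congrArg Zsqrtd.re h2
  have h4 := congrArg Zsqrtd.im h2
  rcases h with rfl | rfl <;> rcases hd with rfl | rfl <;>
  rcases ha with rfl | rfl <;> simp [I] at h3 h4 <;> omega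

/-- one descent step -/
lemma D2 (a b m n : GaussianInt) (hm : ¬ L ∣ m) (ha : ¬ L ∣ a) (hc : IsCoprime a b) (hb : b ≠ 0)
    (h1 : m * n = 2 * I * b ^ 4) (h2 : m + n = - I * a ^ 2) :
    ∃ c d u : GaussianInt, b = c * d ∧ ¬ L ∣ c ∧ IsCoprime c d ∧ u ^ 2 = c ^ 4 - 2 * I * d ^ 4 := by
  have h3 : L * L ∣ n := by
    refine ((cop_L hm).mul_left (cop_L hm)).dvd_of_dvd_mul_left (?_ : _ ∣ m * n)
    rw [h1, hL2]; exact dvd_mul_right _ _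
  rw [hL2] at h3
  obtain ⟨n, rfl⟩ := h3
  have h4 : m * n = b ^ 4 := by
    apply mul_left_cancel₀ (mul_ne_zero two_ne_zero I0)
    linear_combination h1
  have hcop : IsCoprime m n := by
    refine cop_of _ _ (Or.inl (by rintro rfl; simp at hm)) fun p hp h5 h6 => ?_
    have h7 : p ∣ b := hp.dvd_of_dvd_pow (h4 ▸ h5.mul_right n)
    have h8 : p ∣ a ^ 2 := by
      have : a ^ 2 = I * (m + 2 * I * n) := by linear_combination -I * h2 + a ^ 2 * hI
      rw [this]; exact (h5.add (h6.mul_left _)).mul_left _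
    exact hp.not_isUnit (hc.isUnit_of_dvd' (hp.dvd_of_dvd_pow h8) h7)
  obtain ⟨e, f, c, d, hef, rfl, rfl, rfl, hcd⟩ := split 4 (by norm_num) m n b hcop h4 hb
  have hcodd : ¬ L ∣ c := fun h => hm ((dvd_pow h (by norm_num)).mul_left _)
  obtain ⟨k, hk⟩ := odd_4 c hcodd
  obtain ⟨l, hl⟩ := any_4 d
  obtain ⟨j, hj⟩ := odd_sq a ha
  rcases units e f hef with ⟨rfl, rfl⟩ | ⟨rfl, rfl⟩ | ⟨rfl, rfl⟩ | ⟨rfl, rfl⟩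
  · exact (mod2 1 k l j _ _ (Or.inl rfl) hj hl (by rw [← hk]; linear_combination h2)).elim
  · exact (mod2 (-1) k l j _ _ (Or.inr rfl) hj hl (by rw [← hk]; linear_combination h2)).elim
  · exact ⟨c, d, I * a, rfl, hcodd, hcd, by
      linear_combination I * h2 + (-c ^ 4 + 2 * I * d ^ 4) * hI⟩
  · exact ⟨c, d, a, rfl, hcodd, hcd, by
      linear_combination (-I) * h2 + (a ^ 2 * 1 - c ^ 4 + 2 * I * d ^ 4 ) * hI⟩

lemma D (N : ℕ) : ∀ a b u : GaussianInt, b.norm.natAbs = N → ¬ L ∣ a → IsCoprime a b → b ≠ 0 →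
    u ^ 2 = a ^ 4 - 2 * I * b ^ 4 → False := by
  induction N using Nat.strong_induction_on with
  | _ N ih =>
  intro a b u hN ha hc hb h
  have e1 : (a ^ 2 - u) * (a ^ 2 + u) = L * (L * b ^ 4) := by
    linear_combination -h - b ^ 4 * hL2
  have hL : L ∣ a ^ 2 - u ∧ L ∣ a ^ 2 + u := by
    rcases prime_L.dvd_or_dvd (Dvd.intro _ e1.symm) with h1 | h1
    · refine ⟨h1, ?_⟩
      have := (L_dvd_two.mul_right (a ^ 2)).sub h1
      ring_nf at this ⊢; exact this
    · refine ⟨?_, h1⟩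
      have := (L_dvd_two.mul_right (a ^ 2)).sub h1
      ring_nf at this ⊢; exact this
  obtain ⟨⟨m, hm⟩, n, hn⟩ := hL
  have e2 : m * n = b ^ 4 := by
    apply mul_left_cancel₀ L0; apply mul_left_cancel₀ L0
    rw [← e1, hm, hn]; ring
  have e3 : m + n = (1 - I) * a ^ 2 := by
    apply mul_left_cancel₀ L0
    linear_combination -hm - hn + a ^ 2 * hI
  by_cases hbL : L ∣ b
  · obtain ⟨b, rfl⟩ := hbL
    have hL : L ∣ m ∧ L ∣ n := by
      have h0 : L ∣ m + n := by rw [e3]; exact ⟨-I * a ^ 2, by linear_combination a^2 * hI⟩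
      have h5 : L ∣ m * n := by rw [e2]; exact dvd_pow (dvd_mul_right _ _) (by norm_num)
      rcases prime_L.dvd_or_dvd h5 with h1 | h1
      · exact ⟨h1, (dvd_add_right h1).1 h0⟩
      · exact ⟨(dvd_add_left h1).1 h0, h1⟩
    obtain ⟨⟨m, rfl⟩, n, rfl⟩ := hL
    have e4 : m * n = 2 * I * b ^ 4 := by
      apply mul_left_cancel₀ L0; apply mul_left_cancel₀ L0
      linear_combination e2 + L ^ 2 * b ^ 4 * hL2
    have e5 : m + n = -I * a ^ 2 := by
      apply mul_left_cancel₀ L0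
      linear_combination e3 + a ^ 2 * hI
    have hc' : IsCoprime a b := hc.of_mul_right_right
    have hb' : b ≠ 0 := right_ne_zero_of_mul hb
    have key : ∃ c d u : GaussianInt, b = c * d ∧ ¬ L ∣ c ∧ IsCoprime c d ∧
        u ^ 2 = c ^ 4 - 2 * I * d ^ 4 := by
      by_cases hmo : L ∣ m
      · refine D2 a b n m (fun hno => ?_) ha hc' hb' (by rw [mul_comm, e4]) (by rw [add_comm, e5])
        have h6 := (hmo.add hno).mul_left I
        rw [e5] at h6
        have : I * (-I * a ^ 2) = a ^ 2 := by linear_combination -a ^ 2 * hI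
        rw [this] at h6
        exact ha (prime_L.dvd_of_dvd_pow h6)
      · exact D2 a b m n hmo ha hc' hb' e4 e5
    obtain ⟨c, d, v, rfl, hco, hcd, hv⟩ := key
    have hd : d ≠ 0 := right_ne_zero_of_mul hb'
    have hc0 : c ≠ 0 := left_ne_zero_of_mul hb'
    refine ih d.norm.natAbs ?_ c d v rfl hco hcd hd hv
    rw [← hN, Zsqrtd.norm_mul, Zsqrtd.norm_mul, Int.natAbs_mul, Int.natAbs_mul]
    have g1 : (L.norm).natAbs = 2 := by simp [L, Zsqrtd.norm_def]
    have g2 : 0 < c.norm.natAbs := Int.natAbs_pos.2 (by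
      intro h0; exact hc0 ((GaussianInt.norm_eq_zero).1 h0))
    have g3 : 0 < d.norm.natAbs := Int.natAbs_pos.2 (by
      intro h0; exact hd ((GaussianInt.norm_eq_zero).1 h0))
    rw [g1]; nlinarith
  · have hmo : ¬ L ∣ m := fun h1 => hbL (prime_L.dvd_of_dvd_pow (e2 ▸ h1.mul_right n))
    have hcop : IsCoprime m n := by
      refine cop_of _ _ (Or.inl (by rintro rfl; simp at hmo)) fun p hp h5 h6 => ?_
      have h7 : p ∣ b := hp.dvd_of_dvd_pow (e2 ▸ h5.mul_right n)
      have h8 : p ∣ L * a ^ 2 := by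
        have : L * a ^ 2 = I * (m + n) := by linear_combination -I * e3 + a ^ 2 * hI
        rw [this]; exact (h5.add h6).mul_left _
      rcases hp.dvd_or_dvd h8 with h9 | h9
      · exact hbL (((hp.associated_of_dvd prime_L h9).dvd_iff_dvd_left).1 h7)
      · exact hp.not_isUnit (hc.isUnit_of_dvd' (hp.dvd_of_dvd_pow h9) h7)
    obtain ⟨e, f, c, d, hef, rfl, rfl, rfl, hcd⟩ := split 4 (by norm_num) m n b hcop e2 hb
    obtain ⟨k, hk⟩ := odd_4 c (fun h => hbL (h.mul_right _))
    obtain ⟨l, hl⟩ := odd_4 d (fun h => hbL (h.mul_left _))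
    obtain ⟨j, hj⟩ := odd_sq a ha
    exact mod1 e f k l j _ hef hj (by rw [← hk, ← hl]; exact e3)

lemma E2 (p q r u : GaussianInt) (hp : ¬ L ∣ p) (hc : IsCoprime p q) (hr : r ≠ 0)
    (h : p * q = - I * L * r ^ 2) (hu : u ^ 2 = -(p ^ 2 + q ^ 2)) : False := by
  have h3 : L ∣ q := by
    have : L ∣ p * q := ⟨-I * r ^ 2, by rw [h]; ring⟩
    exact (prime_L.dvd_or_dvd this).resolve_left hp
  obtain ⟨q, rfl⟩ := h3
  have h4 : p * (I * q) = r ^ 2 := by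
    apply mul_left_cancel₀ L0
    linear_combination I * h - L * r ^ 2 * hI
  have hc2 : IsCoprime p (I * q) :=
    hc.of_isCoprime_of_dvd_right ⟨-I * L, by linear_combination L * q * hI⟩
  obtain ⟨e, f, a, b, hef, rfl, hq, rfl, hab⟩ := split 2 (by norm_num) p (I * q) r hc2 h4 hr
  have ha : ¬ L ∣ a := fun h => hp ((dvd_pow h (by norm_num)).mul_left _)
  have hq' : q = -I * f * b ^ 2 := by linear_combination -I * hq + q * hI
  subst hq'
  have hb := right_ne_zero_of_mul hr
  rcases units e f hef with ⟨rfl, rfl⟩ | ⟨rfl, rfl⟩ | ⟨rfl, rfl⟩ | ⟨rfl, rfl⟩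
  · refine D _ a b (I * u) rfl ha hab hb ?_
    linear_combination (u ^ 2 + L ^ 2 * b ^ 4) * hI - hu - b ^ 4 * hL2
  · refine D _ a b (I * u) rfl ha hab hb ?_
    linear_combination (u ^ 2 + L ^ 2 * b ^ 4) * hI - hu - b ^ 4 * hL2
  · refine D _ a b u rfl ha hab hb ?_
    linear_combination hu - a ^ 4 * hI - b ^ 4 * hL2 - (L ^ 2 * b ^ 4 * (I ^ 2 - 1)) * hI
  · refine D _ a b u rfl ha hab hb ?_
    linear_combination hu - a ^ 4 * hI - b ^ 4 * hL2 - (L ^ 2 * b ^ 4 * (I ^ 2 - 1)) * hI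

lemma E (s r u v : GaussianInt) (hs : ¬ L ∣ s) (hr : r ≠ 0) (hc : IsCoprime s r) (hrL : L ∣ r)
    (h1 : s ^ 2 + L * r ^ 2 = u ^ 2) (h2 : s ^ 2 + 2 * L * r ^ 2 = v ^ 2) : False := by
  obtain ⟨r, rfl⟩ := hrL
  have e1 : (v - s) * (v + s) = L * (L * (2 * L * r ^ 2)) := by linear_combination -h2
  have hL : L ∣ v - s ∧ L ∣ v + s := by
    have h0 : L ∣ (v + s) - (v - s) := ⟨(1 - I) * s, by linear_combination s * hI⟩
    rcases prime_L.dvd_or_dvd (Dvd.intro _ e1.symm) with h1 | h1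
    · exact ⟨h1, (dvd_sub_left h1).1 h0⟩
    · exact ⟨(dvd_sub_right h1).1 h0, h1⟩
  obtain ⟨⟨α, hα⟩, β, hβ⟩ := hL
  have e2 : α * β = L * (2 * r ^ 2) := by
    apply mul_left_cancel₀ L0; apply mul_left_cancel₀ L0
    rw [hα, hβ] at e1; linear_combination e1
  have e3 : β - α = L * (-I * s) := by
    apply mul_left_cancel₀ L0
    linear_combination hα - hβ + I * s * hL2 + 2 * s * hI
  have hL : L ∣ α ∧ L ∣ β := by
    have h0 : L ∣ β - α := Dvd.intro _ e3.symm
    rcases prime_L.dvd_or_dvd (Dvd.intro _ e2.symm) with h1 | h1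
    · exact ⟨h1, (dvd_sub_left h1).1 h0⟩
    · exact ⟨(dvd_sub_right h1).1 h0, h1⟩
  obtain ⟨⟨q, rfl⟩, p, rfl⟩ := hL
  have e4 : p - q = -I * s := by
    apply mul_left_cancel₀ L0
    linear_combination e3
  have e5 : p * q = -I * L * r ^ 2 := by
    apply mul_left_cancel₀ L0; apply mul_left_cancel₀ L0
    linear_combination e2 + (I * L * r ^ 2) * hL2 + 2 * L * r ^ 2 * hI
  have hs' : s = I * (p - q) := by linear_combination -I * e4 + s * hI
  have hu : u ^ 2 = -(p ^ 2 + q ^ 2) := by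
    have : L * r ^ 2 = I * (p * q) := by linear_combination -I * e5 + L * r ^ 2 * hI
    rw [← h1, hs']
    linear_combination (p - q) ^ 2 * hI + L * r ^ 2 * hL2 + 2 * I * this + 2 * p * q * hI
  have hr' := right_ne_zero_of_mul hr
  have hcop : IsCoprime p q := by
    refine cop_of _ _ ?_ fun t ht h5 h6 => ?_
    · by_contra! h0
      exact hs (by rw [hs', h0.1, h0.2]; simp)
    have h7 : t ∣ s := by rw [hs']; exact (h5.sub h6).mul_left _
    have h8 : t ∣ (L * r) ^ 2 := by
      have : (L * r) ^ 2 = L * I * (p * q) := by linear_combination -L * I * e5 + L ^ 2 * r ^ 2 * hI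
      rw [this]; exact (h5.mul_right _).mul_left _
    exact ht.not_isUnit (hc.isUnit_of_dvd' h7 (ht.dvd_of_dvd_pow h8))
  by_cases hpo : L ∣ p
  · have hqo : ¬ L ∣ q := fun hq => hs (by rw [hs']; exact (hpo.sub hq).mul_left _)
    exact E2 q p r u hqo hcop.symm hr' (by rw [mul_comm, e5]) (by rw [hu]; ring)
  · exact E2 p q r u hpo hcop hr' e5 hu

lemma mod3 (e t k j a2 s2 : GaussianInt) (h : e = I ∨ e = -I) (ha : a2 = 1 + 4 * j ∨ a2 = -1 + 4 * j)
    (hs : s2 = 1 + 4 * k ∨ s2 = -1 + 4 * k)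
    (h2 : s2 + 2 * t = e * a2) : False := by
  have h3 := congrArg Zsqrtd.re h2
  rcases h with rfl | rfl <;> rcases hs with rfl | rfl <;>
  rcases ha with rfl | rfl <;> simp [I] at h3 <;> omega

lemma F (x s r : GaussianInt) (hx : x ≠ 0) (hs : ¬ L ∣ s) (hr : r ≠ 0) (hc : IsCoprime s r)
    (hrL : L ∣ r) (h : x ^ 2 = s ^ 4 + 3 * L * r ^ 2 * s ^ 2 + 4 * I * r ^ 4) : False := by
  have e1 : (s ^ 2 + L * r ^ 2) * (s ^ 2 + 2 * L * r ^ 2) = x ^ 2 := by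
    linear_combination -h + 2 * r ^ 4 * hL2
  have hodd : ¬ L ∣ s ^ 2 + L * r ^ 2 := fun h0 =>
    hs (prime_L.dvd_of_dvd_pow ((dvd_add_left (dvd_mul_right _ _)).1 h0))
  have hcop : IsCoprime (s ^ 2 + L * r ^ 2) (s ^ 2 + 2 * L * r ^ 2) := by
    refine cop_of _ _ (Or.inl (fun h0 => hodd (by rw [h0]; simp))) fun p hp h5 h6 => ?_
    have h7 : p ∣ L * r ^ 2 := by
      have := h6.sub h5; ring_nf at this ⊢; exact this
    have h8 : p ∣ s := hp.dvd_of_dvd_pow ((dvd_add_left h7).1 h5)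
    rcases hp.dvd_or_dvd h7 with h9 | h9
    · exact hs (((hp.associated_of_dvd prime_L h9).dvd_iff_dvd_left).1 h8)
    · exact hp.not_isUnit (hc.isUnit_of_dvd' h8 (hp.dvd_of_dvd_pow h9))
  obtain ⟨e, f, u, v, hef, hu, hv, rfl, -⟩ := split 2 (by norm_num) _ _ x hcop e1 hx
  have huo : ¬ L ∣ u := fun h0 => hodd (by
    rw [hu]; exact (dvd_pow h0 (by norm_num)).mul_left _)
  obtain ⟨k, hk⟩ := odd_sq s hs
  obtain ⟨j, hj⟩ := odd_sq u huo
  have h2 : ∃ t, L * r ^ 2 = 2 * t := by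
    obtain ⟨r, rfl⟩ := hrL
    exact ⟨L * I * r ^ 2, by linear_combination L * r ^ 2 * hL2⟩
  obtain ⟨t, ht⟩ := h2
  rcases units e f hef with ⟨rfl, rfl⟩ | ⟨rfl, rfl⟩ | ⟨rfl, rfl⟩ | ⟨rfl, rfl⟩
  · exact E s r u v hs hr hc hrL (by rw [hu]; ring) (by rw [hv]; ring)
  · exact E s r (I * u) (I * v) hs hr hc hrL (by rw [hu]; linear_combination -u ^ 2 * hI)
      (by rw [hv]; linear_combination -v ^ 2 * hI)
  · exact mod3 I t k j _ _ (Or.inl rfl) hj hk (by rw [← hu, ht])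
  · exact mod3 (-I) t k j _ _ (Or.inr rfl) hj hk (by rw [← hu, ht])

lemma mod4 (e t k j a2 s4 : GaussianInt) (h : e = I ∨ e = -I) (ha : a2 = 1 + 4 * j ∨ a2 = -1 + 4 * j)
    (hs : s4 = 1 + 4 * k) (h2 : a2 = e * s4 + 2 * t) : False := by
  have h3 := congrArg Zsqrtd.re h2
  rcases h with rfl | rfl <;> subst hs <;>
  rcases ha with rfl | rfl <;> simp [I] at h3 <;> omega

lemma G1 (x y a b : GaussianInt) (hx0 : x ≠ 0) (hx : ¬ L ∣ x) (hy : y ≠ 0) (hyL : L ∣ y)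
    (hc : IsCoprime x y)
    (hb : ¬ L ∣ b) (h1 : a * b = 4 * I * y ^ 4) (h2 : a + b = x ^ 2 - 3 * L * y ^ 2) : False := by
  have h3 : (L * L) * (L * L) ∣ a := by
    have h0 := (cop_L hb).mul_left (cop_L hb)
    refine (h0.mul_left h0).dvd_of_dvd_mul_right (?_ : _ ∣ a * b)
    exact ⟨-I * y ^ 4, by
      rw [h1]; linear_combination (I * y ^ 4 * (L ^ 2 + 2 * I)) * hL2 + 4 * I * y ^ 4 * hI⟩
  obtain ⟨a, rfl⟩ := h3
  have h44 : L * L * (L * L) = -4 := by linear_combination (L ^ 2 + 2 * I) * hL2 + 4 * hI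
  rw [h44] at h1 h2
  have h4 : (I * a) * b = y ^ 4 := by
    apply mul_left_cancel₀ (mul_ne_zero four_ne I0)
    linear_combination h1 + 4 * a * b * hI
  have hcop : IsCoprime (I * a) b := by
    refine cop_of _ _ (Or.inr (by rintro rfl; simp at hb)) fun p hp h5 h6 => ?_
    have h7 : p ∣ y := hp.dvd_of_dvd_pow (h4 ▸ h5.mul_right b)
    have h8 : p ∣ x ^ 2 := by
      have : x ^ 2 = I * a * (4 * I) + b + y * (3 * L * y) := by
        linear_combination -h2 - 4 * a * hI
      rw [this]; exact ((h5.mul_right _).add h6).add (h7.mul_right _)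
    exact hp.not_isUnit (hc.isUnit_of_dvd' (hp.dvd_of_dvd_pow h8) h7)
  obtain ⟨f, e, r, s, hef, hra, rfl, rfl, hrs⟩ := split 4 (by norm_num) _ _ y hcop h4 hy
  have ha : a = -I * f * r ^ 4 := by linear_combination -I * hra + a * hI
  subst ha
  have hso : ¬ L ∣ s := fun h0 => hb ((dvd_pow h0 (by norm_num)).mul_left _)
  have hrL : L ∣ r := (prime_L.dvd_or_dvd hyL).resolve_right hso
  have hr0 := left_ne_zero_of_mul hy
  obtain ⟨k, hk⟩ := odd_4 s hso
  obtain ⟨j, hj⟩ := odd_sq x hx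
  have ht : ∃ t, x ^ 2 = e * s ^ 4 + 2 * t := by
    obtain ⟨r, rfl⟩ := hrL
    exact ⟨2 * I * f * (L * r) ^ 4 + 3 * L * I * r ^ 2 * s ^ 2, by
      linear_combination -h2 + (3 * L * r ^ 2 * s ^ 2) * hL2⟩
  obtain ⟨t, ht⟩ := ht
  rcases units e f (by rw [mul_comm, hef]) with ⟨rfl, rfl⟩ | ⟨rfl, rfl⟩ | ⟨rfl, rfl⟩ | ⟨rfl, rfl⟩
  · exact F x s r hx0 hso hr0 hrs.symm hrL (by linear_combination -h2)
  · refine F (I * x) s (I * r) (mul_ne_zero I0 hx0) hso (mul_ne_zero I0 hr0) ?_ (hrL.mul_left _) ?_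
    · exact hrs.symm.of_isCoprime_of_dvd_right ⟨-I, by linear_combination r * hI⟩
    · linear_combination h2 + (x ^ 2 - 3 * L * r ^ 2 * s ^ 2 - 4 * I * r ^ 4 * (I ^ 2 - 1)) * hI
  · exact mod4 I t k j _ _ (Or.inl rfl) hj hk ht
  · exact mod4 (-I) t k j _ _ (Or.inr rfl) hj hk ht

lemma two_dvd_sub (x z : GaussianInt) (hx : ¬ L ∣ x) (hz : ¬ L ∣ z) (t : GaussianInt)
    (h : x ^ 2 = z ^ 2 + 4 * t) : ∃ k, x - z = 2 * k := by
  rw [not_dvd_iff] at hx hz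
  have h1 : (x.re - z.re) % 2 = 0 := by
    by_contra hne
    have h2 := congrArg Zsqrtd.re h
    simp [pow_two] at h2
    obtain ⟨a, b⟩ := x
    obtain ⟨c, d⟩ := z
    simp only at *
    have q (m : ℤ) : (m * m) % 4 = m % 2 := by
      rcases Int.emod_two_eq_zero_or_one m with hm | hm
      · obtain ⟨m, rfl⟩ : ∃ n, m = 2 * n := ⟨m / 2, by omega⟩
        ring_nf; omega
      · obtain ⟨m, rfl⟩ : ∃ n, m = 2 * n + 1 := ⟨m / 2, by omega⟩
        ring_nf; omega
    have q1 := q a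
    have q2 := q b
    have q3 := q c
    have q4 := q d
    omega
  exact ⟨⟨(x.re - z.re) / 2, (x.im - z.im) / 2⟩, by ext <;> simp <;> omega⟩

lemma final (x y z : GaussianInt) (h0 : x * y * z ≠ 0)
    (hg : ∀ d : GaussianInt, d ∣ x → d ∣ y → d ∣ z → IsUnit d) (hyL : L ∣ y)
    (h : x ^ 4 - 6 * L * x ^ 2 * y ^ 2 + 2 * I * y ^ 4 = z ^ 2) : False := by
  have hx0 : x ≠ 0 := left_ne_zero_of_mul (left_ne_zero_of_mul h0)
  have hy0 : y ≠ 0 := right_ne_zero_of_mul (left_ne_zero_of_mul h0)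
  have hc : IsCoprime x y := by
    refine cop_of _ _ (Or.inl hx0) fun p hp h1 h2 => hp.not_isUnit (hg p h1 h2 ?_)
    apply hp.dvd_of_dvd_pow (n := 2)
    rw [← h]
    have : x ^ 4 - 6 * L * x ^ 2 * y ^ 2 + 2 * I * y ^ 4 =
      x * (x ^ 3 - 6 * L * x * y ^ 2) + y * (2 * I * y ^ 3) := by ring
    rw [this]
    exact (h1.mul_right _).add (h2.mul_right _)
  have hx : ¬ L ∣ x := fun h1 => prime_L.not_isUnit (hc.isUnit_of_dvd' h1 hyL)
  have hxy : ∀ w, ¬ L ∣ x ^ 2 + y * w := fun w h1 =>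
    hx (prime_L.dvd_of_dvd_pow ((dvd_add_left (hyL.mul_right _)).1 h1))
  have hz : ¬ L ∣ z := by
    intro h1
    have h2 : L ∣ x ^ 4 := by
      have : x ^ 4 = z * z + y * (6 * L * x ^ 2 * y - 2 * I * y ^ 3) := by linear_combination h
      rw [this]; exact (h1.mul_right _).add (hyL.mul_right _)
    exact hx (prime_L.dvd_of_dvd_pow h2)
  obtain ⟨a, ha⟩ := two_dvd_sub (x ^ 2 - 3 * L * y ^ 2) z
    (by have := hxy (-3 * L * y); ring_nf at this ⊢; exact this) hz (4 * I * y ^ 4) (by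
      linear_combination h + 9 * y ^ 4 * hL2)
  have hab : a * (a + z) = 4 * I * y ^ 4 := by
    apply mul_left_cancel₀ four_ne
    linear_combination h + 9 * y ^ 4 * hL2 - (2 * a + z + (x ^ 2 - 3 * L * y ^ 2)) * ha
  by_cases haL : L ∣ a
  · refine G1 x y a (a + z) hx0 hx hy0 hyL hc (fun h1 => hz ((dvd_add_right haL).1 h1)) hab ?_
    linear_combination -ha
  · refine G1 x y (a + z) a hx0 hx hy0 hyL hc haL (by rw [mul_comm, hab]) ?_
    linear_combination -ha

end GDesc

/-- The equation `x⁴ - 6(1+i)·x²y² + 2i·y⁴ = z²`, with `y` divisible by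
`1 + i`, has no nontrivial solutions over the Gaussian integers. -/
theorem no_nontrivial_solution_x4_sub_6_one_add_i_x2y2_add_2i_y4_eq_z2 :
    ¬ ∃ x y z : GaussianInt, x * y * z ≠ 0 ∧
      (∀ d : GaussianInt, d ∣ x → d ∣ y → d ∣ z → IsUnit d) ∧
      (1 + sqrtd) ∣ y ∧
      x ^ 4 - 6 * (1 + sqrtd) * x ^ 2 * y ^ 2 + 2 * sqrtd * y ^ 4 = z ^ 2 := by
  rintro ⟨x, y, z, h0, hg, hy, h⟩
  exact GDesc.final x y z h0 hg hy h
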